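/- Let α, ε be real numbers with ε ≥ 0 and β ∈ {−1, 1} with α/4 + βε/2 + 1 > 0. Set g(t) = Γ(α/4 + βε/2 + iβt/2 + 1) for t ≥ 0. Then g is continuous and nonvanishing on [0,∞), g(0) is a positive real number, and the unique continuous argument θ : [0,∞) → ℝ of g with θ(0) = 0 satisfies θ(t) = β·[(t/2)·ln(t/(2e)) + π(α + 2)/8] + (β²π/4)·ε + O(1/t) as t → ∞. -/

import Mathlib

open Real Set Filter Asymptotics

/-- The Gamma factor `Γ(α/4 + βε/2 + iβt/2 + 1)` of the paper's appendix. -/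
noncomputable def gammaFactor (α β ε : ℝ) (t : ℝ) : ℂ :=
  Complex.Gamma ((α / 4 + β * ε / 2 : ℝ) + Complex.I * (β * t / 2) + 1)

/-- The real number `φ` is an argument of the complex number `z`. -/
def HasPhase (z : ℂ) (φ : ℝ) : Prop := z = (‖z‖ : ℂ) * Complex.exp (Complex.I * φ)

namespace HasPhase

theorem of_eq_mul_exp {z : ℂ} {φ r : ℝ} (hr : 0 ≤ r)
    (hz : z = (r : ℂ) * Complex.exp (Complex.I * φ)) : HasPhase z φ := by
  have hn : ‖z‖ = r := by
    rw [hz, norm_mul, mul_comm Complex.I, Complex.norm_exp_ofReal_mul_I, Complex.norm_real,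
      Real.norm_of_nonneg hr, mul_one]
  rw [HasPhase, hn, ← hz]

theorem mul {z w : ℂ} {φ ψ : ℝ} (hz : HasPhase z φ) (hw : HasPhase w ψ) :
    HasPhase (z * w) (φ + ψ) := by
  refine of_eq_mul_exp (r := ‖z‖ * ‖w‖) (by positivity) ?_
  conv_lhs => rw [show z = _ from hz, show w = _ from hw]
  push_cast
  rw [mul_add, Complex.exp_add]
  ring

theorem inv {z : ℂ} {φ : ℝ} (hz : HasPhase z φ) : HasPhase z⁻¹ (-φ) := by
  refine of_eq_mul_exp (r := ‖z‖⁻¹) (by positivity) ?_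
  conv_lhs => rw [show z = _ from hz]
  push_cast
  rw [mul_neg, Complex.exp_neg, mul_inv]

theorem ofReal {r : ℝ} (hr : 0 ≤ r) : HasPhase (r : ℂ) 0 :=
  of_eq_mul_exp hr (by simp)

theorem prod {ι : Type*} (s : Finset ι) {z : ι → ℂ} {φ : ι → ℝ}
    (hz : ∀ i ∈ s, HasPhase (z i) (φ i)) : HasPhase (∏ i ∈ s, z i) (∑ i ∈ s, φ i) := by
  classical
  induction s using Finset.induction_on with
  | empty => simpa using ofReal (r := 1) zero_le_one
  | insert i s hi ih =>
    rw [Finset.prod_insert hi, Finset.sum_insert hi]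
    exact (hz i (Finset.mem_insert_self i s)).mul
      (ih fun j hj => hz j (Finset.mem_insert_of_mem hj))

theorem conj {z : ℂ} {φ : ℝ} (hz : HasPhase z φ) :
    HasPhase (starRingEnd ℂ z) (-φ) := by
  refine of_eq_mul_exp (norm_nonneg z) ?_
  conv_lhs => rw [show z = _ from hz]
  rw [map_mul, Complex.conj_ofReal, ← Complex.exp_conj]
  simp

theorem arctan_div {x : ℝ} (hx : 0 < x) (y : ℝ) :
    HasPhase (x + Complex.I * y) (Real.arctan (y / x)) := by
  have hc := Real.cos_arctan_pos (y / x)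
  refine of_eq_mul_exp (r := x / Real.cos (Real.arctan (y / x))) (by positivity) ?_
  have hs : Real.sin (Real.arctan (y / x)) = y / x * Real.cos (Real.arctan (y / x)) := by
    rw [← Real.tan_mul_cos hc.ne', Real.tan_arctan]
  rw [mul_comm Complex.I (Real.arctan (y / x) : ℂ), Complex.exp_mul_I, ← Complex.ofReal_cos,
    ← Complex.ofReal_sin, hs]
  have h1 : (x : ℂ) ≠ 0 := by exact_mod_cast hx.ne'
  have h2 : (Real.cos (Real.arctan (y / x)) : ℂ) ≠ 0 := by exact_mod_cast hc.ne'
  rw [Complex.ofReal_div, Complex.ofReal_mul, Complex.ofReal_div]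
  field_simp

theorem natCast_cpow {n : ℕ} (hn : n ≠ 0) (x y : ℝ) :
    HasPhase ((n : ℂ) ^ (x + Complex.I * y : ℂ)) (y * Real.log n) := by
  have h0 : (n : ℂ) ≠ 0 := by exact_mod_cast hn
  refine of_eq_mul_exp (Real.exp_pos (x * Real.log n)).le ?_
  rw [Complex.cpow_def_of_ne_zero h0, Complex.ofReal_exp, ← Complex.exp_add]
  congr 1
  push_cast [Complex.natCast_log]
  ring

theorem of_tendsto {z : ℕ → ℂ} {φ : ℕ → ℝ} {w : ℂ} {ψ : ℝ}
    (h : ∀ᶠ n in atTop, HasPhase (z n) (φ n)) (hz : Tendsto z atTop (nhds w))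
    (hφ : Tendsto φ atTop (nhds ψ)) : HasPhase w ψ := by
  refine tendsto_nhds_unique_of_eventuallyEq hz ?_ h
  have hc : Tendsto (fun n => (φ n : ℂ)) atTop (nhds (ψ : ℂ)) :=
    (Complex.continuous_ofReal.tendsto ψ).comp hφ
  exact ((Complex.continuous_ofReal.tendsto _).comp hz.norm).mul
    ((Complex.continuous_exp.tendsto _).comp (hc.const_mul Complex.I))

end HasPhase

theorem Complex.GammaSeq_hasPhase {x : ℝ} (hx : 0 < x) (y : ℝ) {n : ℕ} (hn : n ≠ 0) :
    HasPhase (Complex.GammaSeq (x + Complex.I * y) n)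
      (y * Real.log n - ∑ j ∈ Finset.range (n + 1), Real.arctan (y / (x + j))) := by
  have hp : HasPhase (∏ j ∈ Finset.range (n + 1), ((x : ℂ) + Complex.I * y + j))
      (∑ j ∈ Finset.range (n + 1), Real.arctan (y / (x + j))) := by
    refine HasPhase.prod _ fun j _ => ?_
    convert! HasPhase.arctan_div (x := x + j) (by positivity) y using 1
    push_cast
    ring
  have hf : HasPhase (n.factorial : ℂ) 0 := by
    exact_mod_cast HasPhase.ofReal (r := (n.factorial : ℝ)) (by positivity)
  rw [Complex.GammaSeq, div_eq_mul_inv]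
  convert! ((HasPhase.natCast_cpow hn x y).mul hf).mul hp.inv using 1
  ring

/-- Two continuous arguments of the same nonvanishing function on a preconnected set agree as soon
as they agree at one point. -/
theorem HasPhase.eqOn_of_isPreconnected {X : Type*} [TopologicalSpace X] {s : Set X}
    (hs : IsPreconnected s) {g : X → ℂ} (hg : ∀ t ∈ s, g t ≠ 0) {θ φ : X → ℝ}
    (hθ : ContinuousOn θ s) (hφ : ContinuousOn φ s) (hgθ : ∀ t ∈ s, HasPhase (g t) (θ t))
    (hgφ : ∀ t ∈ s, HasPhase (g t) (φ t)) {a : X} (ha : a ∈ s) (h : θ a = φ a) :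
    EqOn θ φ s := by
  intro t ht
  have hmaps : MapsTo (fun t => θ t - φ t) s (AddSubgroup.zmultiples (2 * π) : Set ℝ) := by
    intro u hu
    have hn : (‖g u‖ : ℂ) ≠ 0 := by exact_mod_cast (norm_pos_iff.mpr (hg u hu)).ne'
    have he : Complex.exp (Complex.I * θ u) = Complex.exp (Complex.I * φ u) :=
      mul_left_cancel₀ hn ((hgθ u hu).symm.trans (hgφ u hu))
    obtain ⟨k, hk⟩ := Complex.exp_eq_exp_iff_exists_int.mp he
    refine AddSubgroup.mem_zmultiples_iff.mpr ⟨k, ?_⟩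
    have hkc : (θ u : ℂ) = φ u + k * (2 * π) :=
      mul_left_cancel₀ Complex.I_ne_zero (hk.trans (by ring))
    have hkr : θ u = φ u + k * (2 * π) := by exact_mod_cast hkc
    simp [hkr]
  have hd : IsDiscrete (AddSubgroup.zmultiples (2 * π) : Set ℝ) :=
    isDiscrete_iff_discreteTopology.mpr
      (inferInstanceAs (DiscreteTopology (AddSubgroup.zmultiples (2 * π))))
  have := hs.constant_of_mapsTo hd (hθ.sub hφ) hmaps ht ha
  rw [Pi.sub_apply, Pi.sub_apply, h, sub_self] at this
  exact sub_eq_zero.mp this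

/-- Error bound for the trapezoidal rule on a unit interval, for a function with monotone
derivative. -/
theorem abs_trapezoid_sub_le {F f f' : ℝ → ℝ} {a : ℝ}
    (hF : ∀ u ∈ Icc a (a + 1), HasDerivAt F (f u) u)
    (hf : ∀ u ∈ Icc a (a + 1), HasDerivAt f (f' u) u) (hm : MonotoneOn f' (Icc a (a + 1))) :
    |(f a + f (a + 1)) / 2 - (F (a + 1) - F a)| ≤ (f' (a + 1) - f' a) / 2 := by
  have hD : ∀ u ∈ Icc a (a + 1), HasDerivAt (fun w => (w - a) * (f a + f w) / 2 - (F w - F a))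
      ((1 * (f a + f u) + (u - a) * f' u) / 2 - f u) u := fun u hu =>
    ((((hasDerivAt_id u).sub_const a).mul ((hf u hu).const_add (f a))).div_const 2).sub
      ((hF u hu).sub_const (F a))
  obtain ⟨c, hc, hcD⟩ := exists_hasDerivAt_eq_slope _ _ (lt_add_one a)
    (fun u hu => (hD u hu).continuousAt.continuousWithinAt)
    (fun u hu => hD u (Ioo_subset_Icc_self hu))
  have hsub : Icc a c ⊆ Icc a (a + 1) := Icc_subset_Icc_right hc.2.le
  obtain ⟨ξ, hξ, hξf⟩ := exists_hasDerivAt_eq_slope f f' hc.1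
    (fun u hu => (hf u (hsub hu)).continuousAt.continuousWithinAt)
    (fun u hu => hf u (hsub (Ioo_subset_Icc_self hu)))
  have hca : 0 < c - a := sub_pos.mpr hc.1
  rw [eq_div_iff hca.ne'] at hξf
  have hξc := hm (hsub (Ioo_subset_Icc_self hξ)) (Ioo_subset_Icc_self hc) hξ.2.le
  have haξ := hm (left_mem_Icc.mpr (by linarith)) (hsub (Ioo_subset_Icc_self hξ)) hξ.1.le
  have hcb := hm (Ioo_subset_Icc_self hc) (right_mem_Icc.mpr (by linarith)) hc.2.le
  have hval : (f a + f (a + 1)) / 2 - (F (a + 1) - F a) = (c - a) * (f' c - f' ξ) / 2 := by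
    have h1 : a + 1 - a = 1 := by ring
    simp only [h1, sub_self, zero_mul, zero_div, sub_zero, div_one, one_mul] at hcD
    linarith
  have hc1 : c - a ≤ 1 := by linarith [hc.2]
  rw [hval, abs_of_nonneg (by nlinarith)]
  nlinarith

theorem hasSum_sub_succ_of_antitone {g : ℕ → ℝ} (hg : Antitone g)
    (h0 : Tendsto g atTop (nhds 0)) : HasSum (fun j => g j - g (j + 1)) (g 0) := by
  rw [hasSum_iff_tendsto_nat_of_nonneg fun j => sub_nonneg.mpr (hg j.le_succ)]
  simp_rw [Finset.sum_range_sub']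
  simpa using tendsto_const_nhds.sub h0

/-- A primitive of `v ↦ arctan (y / v)` on `(0, ∞)`. -/
noncomputable def arctanDivPrimitive (y v : ℝ) : ℝ :=
  v * Real.arctan (y / v) + y / 2 * Real.log (v ^ 2 + y ^ 2)

/-- The error of the trapezoidal rule for `v ↦ arctan (y / v)` on `[v, v + 1]`. -/
noncomputable def arctanTrapezoidError (y v : ℝ) : ℝ :=
  (Real.arctan (y / v) + Real.arctan (y / (v + 1))) / 2 -
    (arctanDivPrimitive y (v + 1) - arctanDivPrimitive y v)

theorem hasDerivAt_arctan_div (y : ℝ) {v : ℝ} (hv : 0 < v) :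
    HasDerivAt (fun v => Real.arctan (y / v)) (-(y / (v ^ 2 + y ^ 2))) v := by
  have h := ((hasDerivAt_inv hv.ne').const_mul y).arctan
  simp only [← div_eq_mul_inv] at h
  convert! h using 1
  have : 0 < v ^ 2 + y ^ 2 := by positivity
  field_simp

theorem hasDerivAt_arctanDivPrimitive (y : ℝ) {v : ℝ} (hv : 0 < v) :
    HasDerivAt (arctanDivPrimitive y) (Real.arctan (y / v)) v := by
  have hp : v ^ 2 + y ^ 2 ≠ 0 := by positivity
  have h := ((hasDerivAt_id v).mul (hasDerivAt_arctan_div y hv)).add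
    (((((hasDerivAt_id v).pow 2).add_const (y ^ 2)).log hp).const_mul (y / 2))
  convert! h using 1
  simp
  field_simp
  ring

theorem abs_arctanTrapezoidError_le {y v : ℝ} (hy : 0 ≤ y) (hv : 0 < v) :
    |arctanTrapezoidError y v| ≤
      (y / (v ^ 2 + y ^ 2) - y / ((v + 1) ^ 2 + y ^ 2)) / 2 := by
  have h := abs_trapezoid_sub_le (F := arctanDivPrimitive y) (f := fun v => Real.arctan (y / v))
    (f' := fun v => -(y / (v ^ 2 + y ^ 2))) (a := v)
    (fun u hu => hasDerivAt_arctanDivPrimitive y (hv.trans_le hu.1))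
    (fun u hu => hasDerivAt_arctan_div y (hv.trans_le hu.1))
    (fun u hu w _ huw => by
      have hu0 : 0 < u := hv.trans_le hu.1
      simp only
      gcongr)
  rw [arctanTrapezoidError]
  linarith

theorem hasSum_sub_succ_div_sq_add {x c d : ℝ} (hx : 0 < x) (hc : 0 ≤ c) (hd : 0 ≤ d) :
    HasSum (fun j : ℕ => (c / ((x + j) ^ 2 + d) - c / ((x + j + 1) ^ 2 + d)) / 2)
      (c / (x ^ 2 + d) / 2) := by
  have hanti : Antitone fun j : ℕ => c / ((x + j) ^ 2 + d) := fun i j hij => by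
    have : (i : ℝ) ≤ j := by exact_mod_cast hij
    simp only
    gcongr
  have htop : Tendsto (fun j : ℕ => (x + j : ℝ) ^ 2 + d) atTop atTop :=
    tendsto_atTop_add_const_right _ _
      ((tendsto_pow_atTop two_ne_zero).comp
        (tendsto_atTop_add_const_left _ x tendsto_natCast_atTop_atTop))
  have h := (hasSum_sub_succ_of_antitone hanti (htop.const_div_atTop c)).div_const 2
  simpa [add_assoc] using h

theorem summable_arctanTrapezoidError {x y : ℝ} (hx : 0 < x) (hy : 0 ≤ y) :
    Summable fun j : ℕ => arctanTrapezoidError y (x + j) :=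
  .of_norm_bounded (hasSum_sub_succ_div_sq_add hx hy (sq_nonneg y)).summable
    fun j => abs_arctanTrapezoidError_le hy (by positivity)

theorem abs_tsum_arctanTrapezoidError_le {x y : ℝ} (hx : 0 < x) (hy : 0 ≤ y) :
    |∑' j : ℕ, arctanTrapezoidError y (x + j)| ≤ y / (x ^ 2 + y ^ 2) / 2 := by
  rw [← Real.norm_eq_abs]
  exact tsum_of_norm_bounded (hasSum_sub_succ_div_sq_add hx hy (sq_nonneg y))
    fun j => abs_arctanTrapezoidError_le hy (by positivity)

theorem continuous_arctanDivPrimitive {v : ℝ} (hv : 0 < v) :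
    Continuous fun y => arctanDivPrimitive y v := by
  unfold arctanDivPrimitive
  have (y : ℝ) : v ^ 2 + y ^ 2 ≠ 0 := by positivity
  fun_prop (disch := assumption)

theorem continuousOn_tsum_arctanTrapezoidError {x : ℝ} (hx : 0 < x) (R : ℝ) :
    ContinuousOn (fun y => ∑' j : ℕ, arctanTrapezoidError y (x + j)) (Icc 0 R) := by
  rcases lt_or_ge R 0 with hR | hR
  · simp [Icc_eq_empty_of_lt hR]
  refine continuousOn_tsum (fun j => ?_)
    (hasSum_sub_succ_div_sq_add hx hR le_rfl).summable fun j y hy => ?_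
  · have hv : 0 < x + (j : ℝ) := by positivity
    have := continuous_arctanDivPrimitive hv
    have := continuous_arctanDivPrimitive (add_pos hv one_pos)
    unfold arctanTrapezoidError
    fun_prop
  · have hv : 0 < x + (j : ℝ) := by positivity
    refine (abs_arctanTrapezoidError_le hy.1 hv).trans ?_
    have hdiff : ∀ c d : ℝ, 0 ≤ d → c / ((x + j) ^ 2 + d) - c / ((x + j + 1) ^ 2 + d) =
        c * (2 * (x + j) + 1) / (((x + j) ^ 2 + d) * ((x + j + 1) ^ 2 + d)) := fun c d hd => by
      have h1 : (x + j) ^ 2 + d ≠ 0 := by positivity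
      have h2 : (x + j + 1) ^ 2 + d ≠ 0 := by positivity
      field_simp
      ring
    rw [hdiff y _ (sq_nonneg y), hdiff R 0 le_rfl]
    have hy2 := sq_nonneg y
    have hyR := hy.2
    gcongr

/-- The continuous argument of `y ↦ Γ(x + iy)` on `[0, ∞)` that vanishes at `0`. -/
noncomputable def gammaPhase (x y : ℝ) : ℝ :=
  (x - 1 / 2) * Real.arctan (y / x) + y / 2 * Real.log (x ^ 2 + y ^ 2) - y -
    ∑' j : ℕ, arctanTrapezoidError y (x + j)

theorem gammaPhase_zero (x : ℝ) : gammaPhase x 0 = 0 := by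
  simp [gammaPhase, arctanTrapezoidError, arctanDivPrimitive]

theorem continuousOn_gammaPhase {x : ℝ} (hx : 0 < x) (R : ℝ) :
    ContinuousOn (gammaPhase x) (Icc 0 R) := by
  have (y : ℝ) : x ^ 2 + y ^ 2 ≠ 0 := by positivity
  refine ContinuousOn.sub (Continuous.continuousOn ?_) (continuousOn_tsum_arctanTrapezoidError hx R)
  fun_prop (disch := assumption)

theorem sum_arctan_div (x y : ℝ) (n : ℕ) :
    ∑ j ∈ Finset.range (n + 1), Real.arctan (y / (x + j)) =
      ∑ j ∈ Finset.range n, arctanTrapezoidError y (x + j) +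
        (arctanDivPrimitive y (x + n) - arctanDivPrimitive y x) +
        (Real.arctan (y / x) + Real.arctan (y / (x + n))) / 2 := by
  induction n with
  | zero => simp
  | succ n ih =>
    rw [Finset.sum_range_succ, ih, Finset.sum_range_succ, arctanTrapezoidError]
    push_cast
    rw [← add_assoc]
    ring

theorem tendsto_mul_arctan_div (y : ℝ) :
    Tendsto (fun v => v * Real.arctan (y / v)) atTop (nhds y) := by
  have hd : HasDerivAt (fun u => Real.arctan (y * u)) y 0 := by
    simpa using ((hasDerivAt_id (0 : ℝ)).const_mul y).arctan
  have hinv : Tendsto (fun v : ℝ => v⁻¹) atTop (nhdsWithin 0 {0}ᶜ) :=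
    tendsto_inv_atTop_nhdsGT_zero.mono_right (nhdsWithin_mono _ fun v hv => ne_of_gt hv)
  simpa [Function.comp_def, div_eq_mul_inv] using hd.tendsto_slope_zero.comp hinv

theorem tendsto_phase_GammaSeq {x y : ℝ} (hx : 0 < x) (hy : 0 ≤ y) :
    Tendsto (fun n : ℕ => y * Real.log n -
        ∑ j ∈ Finset.range (n + 1), Real.arctan (y / (x + j)))
      atTop (nhds (gammaPhase x y)) := by
  have hv : Tendsto (fun n : ℕ => x + n) atTop atTop :=
    tendsto_atTop_add_const_left _ x tendsto_natCast_atTop_atTop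
  have hA : Tendsto (fun n : ℕ => Real.arctan (y / (x + n))) atTop (nhds 0) := by
    simpa [Function.comp_def] using (Real.continuous_arctan.tendsto 0).comp (hv.const_div_atTop y)
  have hL : Tendsto (fun n : ℕ => y / 2 * Real.log ((x / n + 1) ^ 2 + (y / n) ^ 2))
      atTop (nhds 0) := by
    have h := (((tendsto_const_div_atTop_nhds_zero_nat x).add_const 1).pow 2).add
      ((tendsto_const_div_atTop_nhds_zero_nat y).pow 2)
    simpa using (h.log (by norm_num)).const_mul (y / 2)
  have hS := (summable_arctanTrapezoidError hx hy).hasSum.tendsto_sum_nat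
  have h := (((hS.add ((tendsto_mul_arctan_div y).comp hv)).add hL).add (hA.div_const 2)).const_sub
    (arctanDivPrimitive y x - Real.arctan (y / x) / 2)
  have hlim : gammaPhase x y = arctanDivPrimitive y x - Real.arctan (y / x) / 2 -
      (∑' j : ℕ, arctanTrapezoidError y (x + j) + y + 0 + 0 / 2) := by
    rw [gammaPhase, arctanDivPrimitive]
    ring
  rw [hlim]
  refine h.congr' ?_
  filter_upwards [eventually_gt_atTop 0] with n hn
  have hn' : (0 : ℝ) < n := by exact_mod_cast hn
  have hq : (x / n + 1) ^ 2 + (y / n) ^ 2 = ((x + n) ^ 2 + y ^ 2) / (n : ℝ) ^ 2 := by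
    field_simp
  have hlog : Real.log ((x / n + 1) ^ 2 + (y / n) ^ 2) =
      Real.log ((x + n) ^ 2 + y ^ 2) - 2 * Real.log n := by
    rw [hq, Real.log_div (by positivity) (by positivity), Real.log_pow]
    norm_num
  rw [sum_arctan_div, hlog]
  simp only [arctanDivPrimitive, Function.comp_apply]
  ring

theorem hasPhase_Gamma {x y : ℝ} (hx : 0 < x) (hy : 0 ≤ y) :
    HasPhase (Complex.Gamma (x + Complex.I * y)) (gammaPhase x y) :=
  .of_tendsto ((eventually_ne_atTop 0).mono fun _ hn => Complex.GammaSeq_hasPhase hx y hn)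
    (Complex.GammaSeq_tendsto_Gamma _) (tendsto_phase_GammaSeq hx hy)

theorem arctan_lt_self {x : ℝ} (hx : 0 < x) : Real.arctan x < x := by
  simpa using Real.lt_tan (Real.arctan_pos.mpr hx) (Real.arctan_lt_pi_div_two x)

/-- The phase form of Stirling's formula on a vertical line. -/
theorem gammaPhase_sub_isBigO {x : ℝ} (hx : 0 < x) :
    (fun y => gammaPhase x y - (y * Real.log y - y + π / 2 * (x - 1 / 2)))
      =O[atTop] fun y => 1 / y := by
  refine IsBigO.of_bound (|x - 1 / 2| * x + x ^ 2 / 2 + 1 / 2) ?_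
  filter_upwards [eventually_gt_atTop 0] with y hy
  have harctan : Real.arctan (y / x) = π / 2 - Real.arctan (x / y) := by
    rw [← Real.arctan_inv_of_pos (div_pos hx hy), inv_div]
  have hlog : Real.log (x ^ 2 + y ^ 2) = 2 * Real.log y + Real.log (1 + (x / y) ^ 2) := by
    rw [show x ^ 2 + y ^ 2 = y ^ 2 * (1 + (x / y) ^ 2) by field_simp; ring,
      Real.log_mul (by positivity) (by positivity), Real.log_pow]
    norm_num
  have heq : gammaPhase x y - (y * Real.log y - y + π / 2 * (x - 1 / 2)) =
      -((x - 1 / 2) * Real.arctan (x / y)) + y / 2 * Real.log (1 + (x / y) ^ 2) -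
        ∑' j : ℕ, arctanTrapezoidError y (x + j) := by
    rw [gammaPhase, harctan, hlog]
    ring
  have h1 : |(x - 1 / 2) * Real.arctan (x / y)| ≤ |x - 1 / 2| * (x / y) := by
    rw [abs_mul, abs_of_pos (Real.arctan_pos.mpr (div_pos hx hy))]
    gcongr
    exact (arctan_lt_self (div_pos hx hy)).le
  have h2 : |y / 2 * Real.log (1 + (x / y) ^ 2)| ≤ y / 2 * (x / y) ^ 2 := by
    rw [abs_of_nonneg (mul_nonneg (by positivity) (Real.log_nonneg (by simp; positivity)))]
    gcongr
    linarith [Real.log_le_sub_one_of_pos (show 0 < 1 + (x / y) ^ 2 by positivity)]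
  have h3 : |∑' j : ℕ, arctanTrapezoidError y (x + j)| ≤ y / y ^ 2 / 2 :=
    (abs_tsum_arctanTrapezoidError_le hx hy.le).trans (by gcongr; nlinarith)
  rw [Real.norm_eq_abs, Real.norm_of_nonneg (by positivity), heq]
  calc _ ≤ |x - 1 / 2| * (x / y) + y / 2 * (x / y) ^ 2 + y / y ^ 2 / 2 := by
        refine (abs_sub _ _).trans (add_le_add ((abs_add_le _ _).trans (add_le_add ?_ h2)) h3)
        rwa [abs_neg]
    _ = _ := by field_simp

theorem gammaFactor_hasPhase {α β ε : ℝ} (hβ : β = -1 ∨ β = 1)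
    (h : 0 < α / 4 + β * ε / 2 + 1) {t : ℝ} (ht : 0 ≤ t) :
    HasPhase (gammaFactor α β ε t) (β * gammaPhase (α / 4 + β * ε / 2 + 1) (t / 2)) := by
  have hG := hasPhase_Gamma h (div_nonneg ht zero_le_two)
  rcases hβ with rfl | rfl
  · convert! hG.conj using 1
    · rw [gammaFactor, ← Complex.Gamma_conj]
      congr 1
      rw [map_add, map_mul, Complex.conj_ofReal, Complex.conj_ofReal, Complex.conj_I]
      push_cast
      ring
    · ring
  · convert! hG using 1
    · rw [gammaFactor]
      congr 1
      push_cast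
      ring
    · ring

theorem re_gammaFactor_argument (α β ε t : ℝ) :
    ((α / 4 + β * ε / 2 : ℝ) + Complex.I * (β * t / 2) + 1 : ℂ).re = α / 4 + β * ε / 2 + 1 := by
  simp

/-- Equation (A.10) of the paper: the asymptotic phase of the Gamma factors
`Γ(α/4 + βε/2 + iβt/2 + 1)` as `t → ∞`. -/
theorem gamma_factor_phase_asymptotic (α ε β : ℝ) (hε : 0 ≤ ε) (hβ : β = -1 ∨ β = 1)
    (h : 0 < α / 4 + β * ε / 2 + 1) :
    ContinuousOn (gammaFactor α β ε) (Ici 0) ∧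
    (∀ t ∈ Ici (0 : ℝ), gammaFactor α β ε t ≠ 0) ∧
    (gammaFactor α β ε 0).im = 0 ∧ 0 < (gammaFactor α β ε 0).re ∧
    ∀ θ : ℝ → ℝ, ContinuousOn θ (Ici 0) → θ 0 = 0 →
      (∀ t ∈ Ici (0 : ℝ),
        gammaFactor α β ε t =
          (‖gammaFactor α β ε t‖ : ℂ) * Complex.exp (Complex.I * θ t)) →
      (fun t : ℝ => θ t -
          (β * (t / 2 * Real.log (t / (2 * Real.exp 1)) + π * (α + 2) / 8) +
            β ^ 2 * π / 4 * ε))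
        =O[atTop] fun t : ℝ => 1 / t := by
  have hne : ∀ t, gammaFactor α β ε t ≠ 0 := fun t =>
    Complex.Gamma_ne_zero_of_re_pos (by rwa [re_gammaFactor_argument])
  have h0 : gammaFactor α β ε 0 = (Real.Gamma (α / 4 + β * ε / 2 + 1) : ℂ) := by
    rw [gammaFactor, ← Complex.Gamma_ofReal]
    simp
  refine ⟨Continuous.continuousOn <| continuous_iff_continuousAt.mpr fun t => ?_,
    fun t _ => hne t, ?_, ?_, fun θ hθ hθ0 hphase => ?_⟩
  · refine ContinuousAt.comp (g := Complex.Gamma)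
      (Complex.continuousAt_Gamma _ fun m hm => ?_) (by fun_prop)
    have hre := congrArg Complex.re hm
    rw [re_gammaFactor_argument, Complex.neg_re, Complex.natCast_re] at hre
    linarith [m.cast_nonneg (α := ℝ)]
  · rw [h0, Complex.ofReal_im]
  · rw [h0, Complex.ofReal_re]
    exact Real.Gamma_pos_of_pos h
  set x := α / 4 + β * ε / 2 + 1 with hx
  have hθeq : ∀ t, 0 ≤ t → θ t = β * gammaPhase x (t / 2) := fun t ht => by
    have hmaps : MapsTo (fun u : ℝ => u / 2) (Icc 0 t) (Icc 0 (t / 2)) := fun u hu =>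
      ⟨div_nonneg hu.1 zero_le_two, by simpa using div_le_div_of_nonneg_right hu.2 zero_le_two⟩
    refine HasPhase.eqOn_of_isPreconnected isPreconnected_Icc (fun u _ => hne u)
      (φ := fun u => β * gammaPhase x (u / 2)) (hθ.mono Icc_subset_Ici_self) ?_
      (fun u hu => hphase u hu.1) (fun u hu => gammaFactor_hasPhase hβ h hu.1)
      (left_mem_Icc.mpr ht) ?_ (right_mem_Icc.mpr ht)
    · exact continuousOn_const.mul
        ((continuousOn_gammaPhase h (t / 2)).comp (by fun_prop) hmaps)
    · simp [hθ0, gammaPhase_zero]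
  have hO := ((gammaPhase_sub_isBigO h).comp_tendsto
    (tendsto_id.atTop_div_const (zero_lt_two' ℝ))).const_mul_left β
  refine (hO.congr' ?_ EventuallyEq.rfl).trans
    (IsBigO.of_bound 2 (Eventually.of_forall fun t => ?_))
  · filter_upwards [eventually_gt_atTop 0] with t ht
    have hlog : Real.log (t / (2 * Real.exp 1)) = Real.log (t / 2) - 1 := by
      rw [← div_div, Real.log_div (by positivity) (by positivity), Real.log_exp]
    rw [hθeq t ht.le, hlog]
    simp only [Function.comp_apply, id]
    rw [hx]
    ring
  · simp [div_eq_mul_inv, mul_comm]
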